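/- Let Λ be a quantum operation on d×d complex matrices with Kraus operators A_1,…,A_K such that E = Σ_k A_kᴴ A_k is positive definite and E ≤ I, and let p_min, p_max be the smallest and largest eigenvalues of E. Define the channel Φ_Λ(σ) = Σ_k (A_k E^{−1/2}) σ (A_k E^{−1/2})ᴴ and its complementary channel Φ̃_Λ(σ) as the K×K matrix whose (α,β) entry is tr(A_α E^{−1/2} σ E^{−1/2} A_βᴴ). Define Γ_Λ(ρ) as the block-diagonal matrix diag(Λ(ρ), tr((I−E)ρ)) and its complementary channel Γ̃_Λ(ρ) as the block-diagonal matrix diag(Φ̃_Λ(√E ρ √E), √(I−E) ρ √(I−E)). Let Q₁(Γ_Λ) = sup over d×d density matrices ρ of [S(Γ_Λ(ρ)) − S(Γ̃_Λ(ρ))] and Q₁(Φ_Λ) = sup over d×d density matrices σ of [S(Φ_Λ(σ)) − S(Φ̃_Λ(σ))]. Then p_min · Q₁(Φ_Λ) − (1 − p_min)·log d ≤ Q₁(Γ_Λ) ≤ p_max · Q₁(Φ_Λ). -/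

import Mathlib

open Matrix ComplexOrder MatrixOrder

/-- The von Neumann entropy S(ρ) = Σ_i −λ_i log λ_i over the eigenvalues of a Hermitian
matrix (and 0 on non-Hermitian matrices). Natural logarithm, 0 log 0 = 0. -/
noncomputable def vnEnt {n : Type*} [Fintype n] [DecidableEq n] (ρ : Matrix n n ℂ) : ℝ :=
  if h : ρ.IsHermitian then ∑ i, -(h.eigenvalues i * Real.log (h.eigenvalues i)) else 0

/-- The entropy as a sum over the roots of the characteristic polynomial. -/
theorem vnEnt_eq_sum_roots {n : Type*} [Fintype n] [DecidableEq n] {M : Matrix n n ℂ}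
    (h : M.IsHermitian) :
    vnEnt M = (M.charpoly.roots.map fun z => Real.negMulLog z.re).sum := by
  rw [vnEnt, dif_pos h, h.roots_charpoly_eq_eigenvalues, Multiset.map_map, Finset.sum]
  simp [Function.comp_def, Real.negMulLog]

theorem vnEnt_fromBlocks_diagonal {m n : Type*} [Fintype m] [DecidableEq m] [Fintype n]
    [DecidableEq n] {M : Matrix m m ℂ} {N : Matrix n n ℂ} (hM : M.IsHermitian)
    (hN : N.IsHermitian) : vnEnt (fromBlocks M 0 0 N) = vnEnt M + vnEnt N := by
  rw [vnEnt_eq_sum_roots (hM.fromBlocks (by simp) hN), vnEnt_eq_sum_roots hM,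
    vnEnt_eq_sum_roots hN, charpoly_fromBlocks_zero₁₂,
    Polynomial.roots_mul (mul_ne_zero (charpoly_monic M).ne_zero (charpoly_monic N).ne_zero),
    Multiset.map_add, Multiset.sum_add]

theorem vnEnt_transpose {n : Type*} [Fintype n] [DecidableEq n] {M : Matrix n n ℂ}
    (h : M.IsHermitian) : vnEnt Mᵀ = vnEnt M := by
  rw [vnEnt_eq_sum_roots h.transpose, vnEnt_eq_sum_roots h, charpoly_transpose]

/-- The nonzero spectra of `X * Xᴴ` and `Xᴴ * X` agree, hence so do the entropies. -/
theorem vnEnt_mul_conjTranspose {m n : Type*} [Fintype m] [DecidableEq m] [Fintype n]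
    [DecidableEq n] (X : Matrix m n ℂ) : vnEnt (X * Xᴴ) = vnEnt (Xᴴ * X) := by
  rw [vnEnt_eq_sum_roots (isHermitian_mul_conjTranspose_self X),
    vnEnt_eq_sum_roots (isHermitian_conjTranspose_mul_self X)]
  have h := congrArg Polynomial.roots (charpoly_mul_comm' X Xᴴ)
  rw [Polynomial.roots_mul (mul_ne_zero (pow_ne_zero _ Polynomial.X_ne_zero)
      (charpoly_monic _).ne_zero),
    Polynomial.roots_mul (mul_ne_zero (pow_ne_zero _ Polynomial.X_ne_zero)
      (charpoly_monic _).ne_zero)] at h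
  have h2 := congrArg (fun s => (s.map fun z : ℂ => Real.negMulLog z.re).sum) h
  simpa [Multiset.map_nsmul, Multiset.sum_nsmul] using h2

theorem charpoly_smul_isHermitian {n : Type*} [Fintype n] [DecidableEq n] {M : Matrix n n ℂ}
    (h : M.IsHermitian) (c : ℂ) :
    (c • M).charpoly = ∏ i, (Polynomial.X - Polynomial.C (c * (h.eigenvalues i : ℂ))) := by
  conv_lhs => rw [h.spectral_theorem, ← map_smul, Unitary.conjStarAlgAut_apply,
    charpoly_mul_comm, ← mul_assoc, ← diagonal_smul, Unitary.coe_star_mul_self, one_mul,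
    charpoly_diagonal]
  simp

theorem vnEnt_smul {n : Type*} [Fintype n] [DecidableEq n] {M : Matrix n n ℂ}
    (h : M.IsHermitian) (c : ℝ) :
    vnEnt ((c : ℂ) • M) = c * vnEnt M + Real.negMulLog c * M.trace.re := by
  have hc : ((c : ℂ) • M).IsHermitian := by
    simp [IsHermitian, conjTranspose_smul, h.eq]
  rw [vnEnt_eq_sum_roots hc, charpoly_smul_isHermitian h, Polynomial.roots_prod _ _
    (Finset.prod_ne_zero_iff.mpr fun i _ => Polynomial.X_sub_C_ne_zero _), vnEnt, dif_pos h,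
    h.trace_eq_sum_eigenvalues]
  simp only [Polynomial.roots_X_sub_C, Multiset.bind_singleton, Multiset.map_map,
    Function.comp_def, ← Complex.ofReal_mul, Complex.ofReal_re, Real.negMulLog_mul]
  rw [← Finset.sum, Finset.sum_add_distrib, add_comm, Finset.mul_sum, Complex.re_sum,
    Finset.mul_sum]
  congr 1
  · simp [Real.negMulLog]
  · simp [mul_comm]

theorem negMulLog_trace_le_vnEnt {n : Type*} [Fintype n] [DecidableEq n] {M : Matrix n n ℂ}
    (h : M.PosSemidef) : Real.negMulLog M.trace.re ≤ vnEnt M := by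
  have ht : M.trace.re = ∑ i, h.1.eigenvalues i := by
    rw [h.1.trace_eq_sum_eigenvalues]; simp
  rw [vnEnt, dif_pos h.1, ht, Real.negMulLog, neg_mul, Finset.sum_mul, ← Finset.sum_neg_distrib]
  refine Finset.sum_le_sum fun i _ => neg_le_neg ?_
  rcases (h.eigenvalues_nonneg i).eq_or_lt with h0 | h0
  · simp [← h0]
  · exact mul_le_mul_of_nonneg_left (Real.log_le_log h0
      (Finset.single_le_sum (fun j _ => h.eigenvalues_nonneg j) (Finset.mem_univ i))) h0.le

theorem vnEnt_le_negMulLog_trace_add {n : Type*} [Fintype n] [DecidableEq n] [Nonempty n]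
    {M : Matrix n n ℂ} (h : M.PosSemidef) :
    vnEnt M ≤ Real.negMulLog M.trace.re + M.trace.re * Real.log (Fintype.card n) := by
  have ht : M.trace.re = ∑ i, h.1.eigenvalues i := by
    rw [h.1.trace_eq_sum_eigenvalues]; simp
  have hn : (Fintype.card n : ℝ) ≠ 0 := by simp
  have hJ := Real.concaveOn_negMulLog.le_map_sum (t := Finset.univ)
    (w := fun _ : n => (Fintype.card n : ℝ)⁻¹) (p := h.1.eigenvalues)
    (fun _ _ => by positivity) (by simp) (fun i _ => h.eigenvalues_nonneg i)
  simp only [smul_eq_mul, ← Finset.mul_sum, ← ht] at hJ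
  have hS : vnEnt M = ∑ i, Real.negMulLog (h.1.eigenvalues i) := by
    simp [vnEnt, dif_pos h.1, Real.negMulLog]
  rw [← hS, mul_comm _ M.trace.re, Real.negMulLog_mul] at hJ
  have h2 : Real.negMulLog (Fintype.card n : ℝ)⁻¹
      = (Fintype.card n : ℝ)⁻¹ * Real.log (Fintype.card n) := by
    rw [Real.negMulLog, Real.log_inv]; ring
  rw [h2] at hJ
  have h3 := mul_le_mul_of_nonneg_left hJ (Nat.cast_nonneg (α := ℝ) (Fintype.card n))
  field_simp at h3
  linarith

theorem vnEnt_of_unique {n : Type*} [Fintype n] [DecidableEq n] [Unique n]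
    {M : Matrix n n ℂ} (h : M.PosSemidef) : vnEnt M = Real.negMulLog M.trace.re :=
  le_antisymm (by simpa using vnEnt_le_negMulLog_trace_add h) (negMulLog_trace_le_vnEnt h)

theorem trace_mul_nonneg_of_posSemidef {n : Type*} [Fintype n] [DecidableEq n]
    {M N : Matrix n n ℂ} (hM : M.PosSemidef) (hN : N.PosSemidef) : 0 ≤ (M * N).trace := by
  obtain ⟨C, rfl⟩ := CStarAlgebra.nonneg_iff_eq_star_mul_self.mp hN.nonneg
  rw [← mul_assoc, trace_mul_comm, ← mul_assoc]
  exact (hM.mul_mul_conjTranspose_same C).trace_nonneg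

theorem iInf_eigenvalues_le_trace_mul {n : Type*} [Fintype n] [DecidableEq n]
    {M ρ : Matrix n n ℂ} (h : M.IsHermitian) (hρ : ρ.PosSemidef) (hρ1 : ρ.trace = 1) :
    ⨅ i, h.eigenvalues i ≤ (M * ρ).trace.re := by
  have h1 : algebraMap ℝ (Matrix n n ℂ) (⨅ i, h.eigenvalues i) ≤ M := by
    refine algebraMap_le_of_le_spectrum (fun x hx => ?_) h
    obtain ⟨i, rfl⟩ := h.spectrum_real_eq_range_eigenvalues ▸ hx
    exact ciInf_le (Set.finite_range _).bddBelow i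
  have h2 := (Complex.le_def.mp (trace_mul_nonneg_of_posSemidef (le_iff.mp h1) hρ)).1
  simpa [sub_mul, Algebra.algebraMap_eq_smul_one, hρ1] using h2

theorem trace_mul_le_iSup_eigenvalues {n : Type*} [Fintype n] [DecidableEq n]
    {M ρ : Matrix n n ℂ} (h : M.IsHermitian) (hρ : ρ.PosSemidef) (hρ1 : ρ.trace = 1) :
    (M * ρ).trace.re ≤ ⨆ i, h.eigenvalues i := by
  have h1 : M ≤ algebraMap ℝ (Matrix n n ℂ) (⨆ i, h.eigenvalues i) := by
    refine le_algebraMap_of_spectrum_le (fun x hx => ?_) h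
    obtain ⟨i, rfl⟩ := h.spectrum_real_eq_range_eigenvalues ▸ hx
    exact le_ciSup (Set.finite_range _).bddAbove i
  have h2 := (Complex.le_def.mp (trace_mul_nonneg_of_posSemidef (le_iff.mp h1) hρ)).1
  simpa [sub_mul, Algebra.algebraMap_eq_smul_one, hρ1] using h2

/-- The completely positive map with Kraus operators `V k`. -/
def krausMap {κ m n : Type*} [Fintype κ] [Fintype n] (V : κ → Matrix m n ℂ)
    (σ : Matrix n n ℂ) : Matrix m m ℂ :=
  ∑ k, V k * σ * (V k)ᴴ

/-- The complementary map of `krausMap V`, with values in the environment. -/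
def krausCompl {κ m n : Type*} [Fintype m] [Fintype n] (V : κ → Matrix m n ℂ)
    (σ : Matrix n n ℂ) : Matrix κ κ ℂ :=
  Matrix.of fun α β => (V α * σ * (V β)ᴴ).trace

theorem krausMap_smul {κ m n : Type*} [Fintype κ] [Fintype n] (V : κ → Matrix m n ℂ)
    (c : ℂ) (σ : Matrix n n ℂ) : krausMap V (c • σ) = c • krausMap V σ := by
  simp [krausMap, Finset.smul_sum]

theorem krausCompl_smul {κ m n : Type*} [Fintype m] [Fintype n] (V : κ → Matrix m n ℂ)
    (c : ℂ) (σ : Matrix n n ℂ) : krausCompl V (c • σ) = c • krausCompl V σ := by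
  ext α β
  simp [krausCompl]

section Kraus

variable {κ m n : Type*} [Fintype κ] [Fintype m] [Fintype n] (V : κ → Matrix m n ℂ)

theorem posSemidef_krausMap {σ : Matrix n n ℂ} (hσ : σ.PosSemidef) :
    (krausMap V σ).PosSemidef :=
  posSemidef_sum _ fun k _ => hσ.mul_mul_conjTranspose_same (V k)

theorem posSemidef_krausCompl [DecidableEq n] {σ : Matrix n n ℂ} (hσ : σ.PosSemidef) :
    (krausCompl V σ).PosSemidef := by
  obtain ⟨C, rfl⟩ := CStarAlgebra.nonneg_iff_eq_star_mul_self.mp hσ.nonneg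
  have h : krausCompl V (star C * C)
      = (Matrix.of fun (α : κ) (ij : m × n) => (V α * Cᴴ) ij.1 ij.2)
        * (Matrix.of fun (α : κ) (ij : m × n) => (V α * Cᴴ) ij.1 ij.2)ᴴ := by
    ext α β
    have h1 : V α * (star C * C) * (V β)ᴴ = (V α * Cᴴ) * (V β * Cᴴ)ᴴ := by
      simp [conjTranspose_mul, star_eq_conjTranspose, Matrix.mul_assoc]
    rw [krausCompl, of_apply, h1, mul_apply, Fintype.sum_prod_type]
    rfl
  rw [h]
  exact posSemidef_self_mul_conjTranspose _

theorem trace_krausMap [DecidableEq n] (hV : ∑ k, (V k)ᴴ * V k = 1) (σ : Matrix n n ℂ) :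
    (krausMap V σ).trace = σ.trace := by
  have h : ∀ k, (V k * σ * (V k)ᴴ).trace = ((V k)ᴴ * V k * σ).trace := fun k => by
    rw [trace_mul_comm, Matrix.mul_assoc]
  rw [krausMap, trace_sum, Finset.sum_congr rfl fun k _ => h k, ← trace_sum, ← Finset.sum_mul,
    hV, one_mul]

theorem trace_krausCompl [DecidableEq n] (hV : ∑ k, (V k)ᴴ * V k = 1) (σ : Matrix n n ℂ) :
    (krausCompl V σ).trace = σ.trace := by
  rw [← trace_krausMap _ hV, krausMap, trace_sum]
  rfl

/-- On pure states a Kraus map and its complement have equal output entropy. -/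
theorem vnEnt_krausMap_vecMulVec [DecidableEq κ] [DecidableEq m] (ψ : n → ℂ) :
    vnEnt (krausMap V (vecMulVec ψ (star ψ))) = vnEnt (krausCompl V (vecMulVec ψ (star ψ))) := by
  let X : Matrix m κ ℂ := Matrix.of fun i k => (V k *ᵥ ψ) i
  have hk : ∀ α β, V α * vecMulVec ψ (star ψ) * (V β)ᴴ
      = vecMulVec (V α *ᵥ ψ) (star (V β *ᵥ ψ)) := fun α β => by
    rw [mul_vecMulVec, vecMulVec_mul, star_mulVec]
  have h1 : krausMap V (vecMulVec ψ (star ψ)) = X * Xᴴ := by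
    ext i j
    simp only [krausMap, hk, Matrix.sum_apply, mul_apply]
    rfl
  have h2 : krausCompl V (vecMulVec ψ (star ψ)) = (Xᴴ * X)ᵀ := by
    ext α β
    rw [krausCompl, of_apply, hk, trace_vecMulVec, dotProduct_comm, transpose_apply, mul_apply]
    rfl
  rw [h1, h2, vnEnt_transpose (isHermitian_conjTranspose_mul_self X), vnEnt_mul_conjTranspose]

end Kraus

/-- p_min·Q₁(Φ_Λ) − (1 − p_min)·log d ≤ Q₁(Γ_Λ) ≤ p_max·Q₁(Φ_Λ), where
Q₁ denotes the supremum of the coherent information over density matrices, Φ_Λ is the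
channel with Kraus operators A_k E^{−1/2} (with complementary channel Φ̃_Λ), and Γ_Λ is
the generalized erasure channel of Λ (with complementary channel Γ̃_Λ). -/
theorem coherent_information_gec_bounds (d K : ℕ) (hd : 1 ≤ d)
    (A : Fin K → Matrix (Fin d) (Fin d) ℂ)
    (E : Matrix (Fin d) (Fin d) ℂ) (hE : E = ∑ k, (A k)ᴴ * A k)
    (hEpd : E.PosDef) (hE1 : (1 - E).PosSemidef)
    -- E^{−1/2}, √E and √(I−E)
    (W : Matrix (Fin d) (Fin d) ℂ) (hW : W = (CFC.sqrt E)⁻¹)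
    (sqE : Matrix (Fin d) (Fin d) ℂ) (hsqE : sqE = CFC.sqrt E)
    (Bm : Matrix (Fin d) (Fin d) ℂ) (hBm : Bm = CFC.sqrt (1 - E))
    -- the channel Φ_Λ and its complementary channel
    (Φ : Matrix (Fin d) (Fin d) ℂ → Matrix (Fin d) (Fin d) ℂ)
    (hΦ : ∀ σ, Φ σ = ∑ k, (A k * W) * σ * (A k * W)ᴴ)
    (Φc : Matrix (Fin d) (Fin d) ℂ → Matrix (Fin K) (Fin K) ℂ)
    (hΦc : ∀ σ, Φc σ = Matrix.of fun α β => (A α * W * σ * W * (A β)ᴴ).trace)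
    -- the generalized erasure channel Γ_Λ and its complementary channel
    (Γ : Matrix (Fin d) (Fin d) ℂ → Matrix (Fin d ⊕ Fin 1) (Fin d ⊕ Fin 1) ℂ)
    (hΓ : ∀ ρ, Γ ρ = Matrix.fromBlocks (∑ k, A k * ρ * (A k)ᴴ) 0 0
        (Matrix.of fun _ _ => ((1 - E) * ρ).trace))
    (Γc : Matrix (Fin d) (Fin d) ℂ → Matrix (Fin K ⊕ Fin d) (Fin K ⊕ Fin d) ℂ)
    (hΓc : ∀ ρ, Γc ρ = Matrix.fromBlocks (Φc (sqE * ρ * sqE)) 0 0 (Bm * ρ * Bm)) :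
    (⨅ i, hEpd.1.eigenvalues i) *
        sSup {x : ℝ | ∃ σ : Matrix (Fin d) (Fin d) ℂ, σ.PosSemidef ∧ σ.trace = 1 ∧
          x = vnEnt (Φ σ) - vnEnt (Φc σ)}
      - (1 - ⨅ i, hEpd.1.eigenvalues i) * Real.log d
      ≤ sSup {x : ℝ | ∃ ρ : Matrix (Fin d) (Fin d) ℂ, ρ.PosSemidef ∧ ρ.trace = 1 ∧
          x = vnEnt (Γ ρ) - vnEnt (Γc ρ)} ∧
    sSup {x : ℝ | ∃ ρ : Matrix (Fin d) (Fin d) ℂ, ρ.PosSemidef ∧ ρ.trace = 1 ∧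
          x = vnEnt (Γ ρ) - vnEnt (Γc ρ)}
      ≤ (⨆ i, hEpd.1.eigenvalues i) *
        sSup {x : ℝ | ∃ σ : Matrix (Fin d) (Fin d) ℂ, σ.PosSemidef ∧ σ.trace = 1 ∧
          x = vnEnt (Φ σ) - vnEnt (Φc σ)} := by
  have : NeZero d := ⟨by omega⟩
  have hEsq : sqE * sqE = E := by
    rw [hsqE]; exact CFC.sqrt_mul_sqrt_self E hEpd.posSemidef.nonneg
  have hsqEh : sqEᴴ = sqE := by
    rw [hsqE]; exact (nonneg_iff_posSemidef.mp (CFC.sqrt_nonneg E)).1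
  have hBB : Bm * Bm = 1 - E := by
    rw [hBm]; exact CFC.sqrt_mul_sqrt_self _ hE1.nonneg
  have hBh : Bmᴴ = Bm := by
    rw [hBm]; exact (nonneg_iff_posSemidef.mp (CFC.sqrt_nonneg (1 - E))).1
  have hdet : IsUnit sqE.det := by
    refine isUnit_of_mul_isUnit_left (y := sqE.det) ?_
    rw [← det_mul, hEsq]
    exact hEpd.det_pos.ne'.isUnit
  rw [← hsqE] at hW
  have hWs : W * sqE = 1 := hW ▸ nonsing_inv_mul _ hdet
  have hsW : sqE * W = 1 := hW ▸ mul_nonsing_inv _ hdet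
  have hWh : Wᴴ = W := by rw [hW, conjTranspose_nonsing_inv, hsqEh]
  have hV : ∑ k, (A k * W)ᴴ * (A k * W) = 1 := by
    calc ∑ k, (A k * W)ᴴ * (A k * W) = W * (∑ k, (A k)ᴴ * A k) * W := by
          simp only [conjTranspose_mul, hWh, Finset.mul_sum, Finset.sum_mul, mul_assoc]
      _ = (W * sqE) * (sqE * W) := by rw [← hE, ← hEsq]; simp only [mul_assoc]
      _ = 1 := by rw [hWs, hsW, one_mul]
  replace hΦ : ∀ σ, Φ σ = krausMap (fun k => A k * W) σ := hΦ
  replace hΦc : ∀ σ, Φc σ = krausCompl (fun k => A k * W) σ := fun σ => by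
    rw [hΦc]; ext α β
    simp [krausCompl, conjTranspose_mul, hWh, mul_assoc]
  have key : ∀ (ρ σ : Matrix (Fin d) (Fin d) ℂ) (p : ℝ), ρ.PosSemidef → ρ.trace = 1 →
      σ.PosSemidef → σ.trace = 1 → sqE * ρ * sqE = (p : ℂ) • σ →
      p * (vnEnt (Φ σ) - vnEnt (Φc σ)) - (1 - p) * Real.log d ≤ vnEnt (Γ ρ) - vnEnt (Γc ρ) ∧
      vnEnt (Γ ρ) - vnEnt (Γc ρ) ≤ p * (vnEnt (Φ σ) - vnEnt (Φc σ)) := by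
    intro ρ σ p hρ hρ1 hσ hσ1 h
    have hΦp : (Φ σ).PosSemidef := hΦ σ ▸ posSemidef_krausMap _ hσ
    have hΦcp : (Φc σ).PosSemidef := hΦc σ ▸ posSemidef_krausCompl _ hσ
    have hΦt : (Φ σ).trace = 1 := by rw [hΦ, trace_krausMap _ hV, hσ1]
    have hΦct : (Φc σ).trace = 1 := by rw [hΦc, trace_krausCompl _ hV, hσ1]
    have hEρ : (E * ρ).trace = p := by
      rw [← hEsq, mul_assoc, trace_mul_comm, h, trace_smul, hσ1, smul_eq_mul, mul_one]
    have hout : ∑ k, A k * ρ * (A k)ᴴ = (p : ℂ) • Φ σ := by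
      rw [hΦ, ← krausMap_smul, ← h]
      refine Finset.sum_congr rfl fun k _ => ?_
      calc A k * ρ * (A k)ᴴ = A k * (W * sqE) * ρ * (sqE * W) * (A k)ᴴ := by
            rw [hWs, hsW, mul_one, mul_one]
        _ = _ := by simp only [conjTranspose_mul, hWh, mul_assoc]
    have hflag : ((1 - E) * ρ).trace = ((1 - p : ℝ) : ℂ) := by
      rw [sub_mul, trace_sub, one_mul, hρ1, hEρ]; simp
    have hp1 : 0 ≤ 1 - p := by
      have := trace_mul_nonneg_of_posSemidef hE1 hρ
      rw [hflag] at this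
      exact_mod_cast this
    have hF : (Matrix.of fun _ _ : Fin 1 => ((1 - E) * ρ).trace).PosSemidef := by
      have h1 : (Matrix.of fun _ _ : Fin 1 => ((1 - E) * ρ).trace)
          = (((1 - p : ℝ) : ℂ)) • (1 : Matrix (Fin 1) (Fin 1) ℂ) := by
        ext i j; simp [hflag, Subsingleton.elim i j]
      rw [h1]
      exact PosSemidef.one.smul (by exact_mod_cast hp1)
    have hFt : (Matrix.of fun _ _ : Fin 1 => ((1 - E) * ρ).trace).trace.re = 1 - p := by
      simp only [trace_fin_one, of_apply, hflag, Complex.ofReal_re]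
    have hBp : (Bm * ρ * Bm).PosSemidef := by
      simpa only [hBh] using hρ.mul_mul_conjTranspose_same Bm
    have hBt : (Bm * ρ * Bm).trace.re = 1 - p := by
      rw [trace_mul_comm, ← mul_assoc, hBB, hflag, Complex.ofReal_re]
    have hsm : ∀ {ι : Type} {M : Matrix ι ι ℂ}, M.IsHermitian → ((p : ℂ) • M).IsHermitian := by
      intro ι M hM
      simp [IsHermitian, conjTranspose_smul, hM.eq]
    have hlow := negMulLog_trace_le_vnEnt hBp
    have hupp := vnEnt_le_negMulLog_trace_add hBp
    rw [hBt] at hlow hupp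
    rw [Fintype.card_fin] at hupp
    have hcomp : Φc (sqE * ρ * sqE) = (p : ℂ) • Φc σ := by
      rw [h, hΦc, hΦc, krausCompl_smul]
    rw [hΓ, hΓc, hout, hcomp, vnEnt_fromBlocks_diagonal (hsm hΦp.1) hF.1,
      vnEnt_fromBlocks_diagonal (hsm hΦcp.1) hBp.1, vnEnt_smul hΦp.1, vnEnt_smul hΦcp.1,
      vnEnt_of_unique hF, hFt, hΦt, hΦct]
    constructor <;> linarith
  have hbound : ∀ σ : Matrix (Fin d) (Fin d) ℂ, σ.PosSemidef → σ.trace = 1 →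
      vnEnt (Φ σ) - vnEnt (Φc σ) ≤ Real.log d := by
    intro σ hσ hσ1
    have h1 := vnEnt_le_negMulLog_trace_add (posSemidef_krausMap (fun k => A k * W) hσ)
    have h2 := negMulLog_trace_le_vnEnt (posSemidef_krausCompl (fun k => A k * W) hσ)
    rw [trace_krausMap _ hV, hσ1] at h1
    rw [trace_krausCompl _ hV, hσ1] at h2
    simp only [Complex.one_re, Real.negMulLog_one, Fintype.card_fin] at h1 h2
    rw [hΦ, hΦc]
    linarith
  set SΦ := {x : ℝ | ∃ σ : Matrix (Fin d) (Fin d) ℂ, σ.PosSemidef ∧ σ.trace = 1 ∧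
    x = vnEnt (Φ σ) - vnEnt (Φc σ)}
  set SΓ := {x : ℝ | ∃ ρ : Matrix (Fin d) (Fin d) ℂ, ρ.PosSemidef ∧ ρ.trace = 1 ∧
    x = vnEnt (Γ ρ) - vnEnt (Γc ρ)}
  set pmin := ⨅ i, hEpd.1.eigenvalues i
  set pmax := ⨆ i, hEpd.1.eigenvalues i
  have hSΦb : BddAbove SΦ := ⟨Real.log d, by rintro x ⟨σ, hσ, hσ1, rfl⟩; exact hbound σ hσ hσ1⟩
  have hzero : (0 : ℝ) ∈ SΦ := by
    refine ⟨vecMulVec (Pi.single 0 1) (star (Pi.single 0 1)), posSemidef_vecMulVec_self_star _,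
      by simp [trace_vecMulVec], ?_⟩
    rw [hΦ, hΦc, vnEnt_krausMap_vecMulVec, sub_self]
  have hpmin : 0 < pmin := by
    obtain ⟨i, hi⟩ := exists_eq_ciInf_of_finite (f := hEpd.1.eigenvalues)
    exact (hEpd.eigenvalues_pos i).trans_eq hi
  have hlog : 0 ≤ Real.log d := Real.log_nonneg (by exact_mod_cast hd)
  have upper : ∀ y ∈ SΓ, y ≤ pmax * sSup SΦ := by
    rintro y ⟨ρ, hρ, hρ1, rfl⟩
    have hτ : (sqE * ρ * sqE).PosSemidef := by
      simpa only [hsqEh] using hρ.mul_mul_conjTranspose_same sqE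
    have hp0 : 0 < (E * ρ).trace.re :=
      hpmin.trans_le (iInf_eigenvalues_le_trace_mul hEpd.1 hρ hρ1)
    have hpc : (((E * ρ).trace.re : ℝ) : ℂ) = (sqE * ρ * sqE).trace := by
      rw [trace_mul_comm (sqE * ρ), ← mul_assoc, hEsq]
      exact (Complex.eq_re_of_ofReal_le (r := 0)
        (by simpa using trace_mul_nonneg_of_posSemidef hEpd.posSemidef hρ)).symm
    set p := (E * ρ).trace.re
    have hpne : (p : ℂ) ≠ 0 := by exact_mod_cast hp0.ne'
    have hσ : ((p : ℂ)⁻¹ • (sqE * ρ * sqE)).PosSemidef :=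
      hτ.smul (by exact_mod_cast (inv_pos.mpr hp0).le)
    have hσ1 : ((p : ℂ)⁻¹ • (sqE * ρ * sqE)).trace = 1 := by
      rw [trace_smul, ← hpc, smul_eq_mul, inv_mul_cancel₀ hpne]
    refine (key ρ _ p hρ hρ1 hσ hσ1 (smul_inv_smul₀ hpne _).symm).2.trans ?_
    exact (mul_le_mul_of_nonneg_left (le_csSup hSΦb ⟨_, hσ, hσ1, rfl⟩) hp0.le).trans
      (mul_le_mul_of_nonneg_right (trace_mul_le_iSup_eigenvalues hEpd.1 hρ hρ1)
        (le_csSup hSΦb hzero))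
  have lower : ∀ x ∈ SΦ, 0 ≤ x → pmin * x - (1 - pmin) * Real.log d ≤ sSup SΓ := by
    rintro x ⟨σ, hσ, hσ1, rfl⟩ hx
    have hτ : (W * σ * W).PosSemidef := by
      simpa only [hWh] using hσ.mul_mul_conjTranspose_same W
    have hback : sqE * (W * σ * W) * sqE = σ := by
      calc sqE * (W * σ * W) * sqE = (sqE * W) * σ * (W * sqE) := by simp only [mul_assoc]
        _ = σ := by rw [hsW, hWs, one_mul, mul_one]
    have htc : (((W * σ * W).trace.re : ℝ) : ℂ) = (W * σ * W).trace :=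
      (Complex.eq_re_of_ofReal_le (r := 0) (by simpa using hτ.trace_nonneg)).symm
    have htne : (W * σ * W).trace ≠ 0 := by
      intro h0
      rw [hτ.trace_eq_zero_iff] at h0
      rw [h0, mul_zero, zero_mul] at hback
      simp [← hback] at hσ1
    set t := (W * σ * W).trace.re
    have ht0 : 0 < t := by
      refine lt_of_le_of_ne (Complex.le_def.mp hτ.trace_nonneg).1 fun h0 => htne ?_
      rw [← htc, ← h0, Complex.ofReal_zero]
    have hρ : (((t⁻¹ : ℝ) : ℂ) • (W * σ * W)).PosSemidef :=
      hτ.smul (by exact_mod_cast (inv_pos.mpr ht0).le)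
    have hρ1 : (((t⁻¹ : ℝ) : ℂ) • (W * σ * W)).trace = 1 := by
      rw [trace_smul, Complex.ofReal_inv, htc, smul_eq_mul, inv_mul_cancel₀ htne]
    have hsand : sqE * (((t⁻¹ : ℝ) : ℂ) • (W * σ * W)) * sqE = ((t⁻¹ : ℝ) : ℂ) • σ := by
      rw [mul_smul_comm, smul_mul_assoc, hback]
    have hp : pmin ≤ t⁻¹ := by
      have hEt : (E * (((t⁻¹ : ℝ) : ℂ) • (W * σ * W))).trace = ((t⁻¹ : ℝ) : ℂ) := by
        rw [← hEsq, mul_assoc, trace_mul_comm, hsand, trace_smul, hσ1, smul_eq_mul, mul_one]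
      simpa only [hEt, Complex.ofReal_re] using iInf_eigenvalues_le_trace_mul hEpd.1 hρ hρ1
    refine le_trans ?_ ((key _ σ t⁻¹ hρ hρ1 hσ hσ1 hsand).1.trans
      (le_csSup ⟨_, upper⟩ ⟨_, hρ, hρ1, rfl⟩))
    nlinarith [mul_le_mul_of_nonneg_right hp hx, mul_le_mul_of_nonneg_right hp hlog]
  refine ⟨?_, csSup_le ?_ upper⟩
  · rw [sub_le_iff_le_add, ← le_div_iff₀' hpmin]
    refine csSup_le ⟨0, hzero⟩ fun x hx => ?_
    rw [le_div_iff₀' hpmin, ← sub_le_iff_le_add]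
    rcases le_total 0 x with h0 | h0
    · exact lower x hx h0
    · have := lower 0 hzero le_rfl
      nlinarith [mul_nonneg hpmin.le (neg_nonneg.mpr h0)]
  · exact ⟨_, _, posSemidef_vecMulVec_self_star (Pi.single 0 1),
      by simp [trace_vecMulVec], rfl⟩
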